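/- For each integer m ≥ 0, the variety C_m is a definable element of the lattice Com. -/

import Mathlib

open FirstOrder

/-! ### Words, identities, and commutative semigroup varieties -/

/-- Semigroup words over the countable alphabet `ℕ`. -/
abbrev SGWord : Type := FreeSemigroup ℕ

/-- A semigroup identity `u = v` is a pair of words. -/
abbrev SGId : Type := SGWord × SGWord

/-- The one-letter word consisting of the letter `n`. -/
def ltr (n : ℕ) : SGWord := FreeSemigroup.of n

/-- `wpow w n` is the word `w^n` (for `n ≥ 1`; by convention `wpow w 0 = w`). -/
def wpow (w : SGWord) : ℕ → SGWord
  | 0 => w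
  | 1 => w
  | n + 2 => wpow w (n + 1) * w

/-- The letter `n` occurs in the word `w`. -/
def OccursIn (n : ℕ) (w : SGWord) : Prop := n = w.head ∨ n ∈ w.tail

/-- A semigroup `S` satisfies the identity `i.1 = i.2` if all evaluations of the two
words in `S` coincide. -/
def SGSatisfies (S : Type) [Semigroup S] (i : SGId) : Prop :=
  ∀ f : ℕ → S, FreeSemigroup.lift f i.1 = FreeSemigroup.lift f i.2

/-- A bundled (nonempty) commutative semigroup. -/
structure ComSG where
  carrier : Type
  [str : CommSemigroup carrier]
  [instNonempty : Nonempty carrier]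

attribute [instance] ComSG.str ComSG.instNonempty

/-- The class of commutative semigroups satisfying every identity in `E`. -/
def modelsOf (E : Set SGId) : Set ComSG := {S | ∀ i ∈ E, SGSatisfies S.carrier i}

/-- The set of identities holding in every member of the class `K`. -/
def theoryOfClass (K : Set ComSG) : Set SGId := {i | ∀ S ∈ K, SGSatisfies S.carrier i}

theorem subset_theoryOfClass_modelsOf (E : Set SGId) : E ⊆ theoryOfClass (modelsOf E) :=
  fun i hi S hS => hS i hi

theorem theoryOfClass_antitone {K K' : Set ComSG} (h : K ⊆ K') :
    theoryOfClass K' ⊆ theoryOfClass K := fun _ hi S hS => hi S (h hS)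

theorem modelsOf_antitone {E E' : Set SGId} (h : E ⊆ E') : modelsOf E' ⊆ modelsOf E :=
  fun _ hS i hi => hS i (h hi)

/-- A variety of commutative semigroups, identified with its (equationally closed)
equational theory.  Varieties are ordered by inclusion of the corresponding classes
of semigroups, i.e. by *reverse* inclusion of theories. -/
structure ComVariety where
  theory : Set SGId
  closed : theoryOfClass (modelsOf theory) = theory

theorem ComVariety.ext' {V W : ComVariety} (h : V.theory = W.theory) : V = W := by
  cases V; cases W; cases h; rfl

instance : PartialOrder ComVariety where
  le V W := W.theory ⊆ V.theory
  le_refl V := subset_rfl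
  le_trans U V W h1 h2 := fun i hi => h1 (h2 hi)
  le_antisymm V W h1 h2 := ComVariety.ext' (subset_antisymm h2 h1)

instance : SupSet ComVariety where
  sSup s :=
    { theory := ⋂ V ∈ s, V.theory
      closed := by
        apply subset_antisymm
        · intro i hi
          refine Set.mem_iInter₂.2 fun V hV => ?_
          have h1 : (⋂ V ∈ s, ComVariety.theory V) ⊆ V.theory := Set.biInter_subset_of_mem hV
          have h2 := theoryOfClass_antitone (modelsOf_antitone h1)
          rw [V.closed] at h2
          exact h2 hi
        · exact subset_theoryOfClass_modelsOf _ }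

/-- The lattice **Com** of all commutative semigroup varieties. -/
instance : CompleteLattice ComVariety :=
  completeLatticeOfSup ComVariety fun s => by
    constructor
    · intro V hV i hi
      exact Set.mem_iInter₂.1 hi V hV
    · intro W hW i hi
      exact Set.mem_iInter₂.2 fun V hV => hW hV hi

/-- The variety of commutative semigroups given by the identity system `E`. -/
def comVar (E : Set SGId) : ComVariety where
  theory := theoryOfClass (modelsOf E)
  closed := by
    apply subset_antisymm
    · exact theoryOfClass_antitone fun S hS i hi => hi S hS
    · exact subset_theoryOfClass_modelsOf _

/-! ### The first-order language of lattices and definability -/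

/-- The first-order language of lattices: two binary function symbols (`true` for the
join `∨` and `false` for the meet `∧`) and nothing else. -/
def latticeLang : Language where
  Functions := fun n => match n with | 2 => Bool | _ => Empty
  Relations := fun _ => Empty

instance latticeLangStructure (L : Type*) [Lattice L] : latticeLang.Structure L where
  funMap {n} f x :=
    match n, f with
    | 2, b => bif b then x 0 ⊔ x 1 else x 0 ⊓ x 1
    | 0, f => f.elim
    | 1, f => f.elim
    | (_ + 3), f => f.elim
  RelMap {n} r _ := r.elim

/-- A subset `A` of a lattice `L` is definable in `L` if there is a first-order formula
`φ(x)` with one free variable in the language of the lattice operations `∨` and `∧`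
such that for every `a ∈ L`, `φ(a)` holds in `L` if and only if `a ∈ A`. -/
def LatDefinable (L : Type*) [Lattice L] (A : Set L) : Prop :=
  ∃ φ : latticeLang.Formula (Fin 1), ∀ a : L, (φ.Realize fun _ => a) ↔ a ∈ A

/-! ### Named varieties -/

/-- The commutativity identity `xy = yx`. -/
def commId : SGId := (ltr 0 * ltr 1, ltr 1 * ltr 0)

/-- The pair of identities abbreviated by the symbolic identity `w = 0`, namely
`wx = w` and `xw = w`, where `x` is the letter `n` (assumed not to occur in `w`). -/
def zeroId (w : SGWord) (n : ℕ) : Set SGId := {(w * ltr n, w), (ltr n * w, w)}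

/-- `A n = var{xⁿy = y, xy = yx}`, the variety of Abelian groups of exponent dividing `n`. -/
def Avar (n : ℕ) : ComVariety := comVar {(wpow (ltr 0) n * ltr 1, ltr 1), commId}

/-- `SL = var{x² = x, xy = yx}`, the variety of semilattices. -/
def SLvar : ComVariety := comVar {(wpow (ltr 0) 2, ltr 0), commId}

/-- `ZM = var{xy = 0}` (within **Com**), the variety of null semigroups. -/
def ZMvar : ComVariety := comVar ({commId} ∪ zeroId (ltr 0 * ltr 1) 2)

/-- `T = var{x = y}`, the trivial variety. -/
def Tvar : ComVariety := comVar {(ltr 0, ltr 1)}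

/-- `COM`, the variety of all commutative semigroups. -/
def COMvar : ComVariety := comVar {commId}

/-- `C m = var{xᵐ = xᵐ⁺¹, xy = yx}` (the variety generated by the cyclic monoid
`⟨a ∣ aᵐ = aᵐ⁺¹⟩`), with the convention `C 0 = T`. -/
def Cvar : ℕ → ComVariety
  | 0 => Tvar
  | m + 1 => comVar {(wpow (ltr 0) (m + 1), wpow (ltr 0) (m + 2)), commId}

/-- `D m = var{xᵐ = 0, xy = yx}`. -/
def Dvar (m : ℕ) : ComVariety := comVar ({commId} ∪ zeroId (wpow (ltr 0) m) 1)

/-- The word `x₁x₂⋯x_k` (in the letters `0, 1, …, k-1`), for `k ≥ 1`. -/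
def chainWord : ℕ → SGWord
  | 0 => ltr 0
  | 1 => ltr 0
  | k + 2 => chainWord (k + 1) * ltr (k + 1)

/-- `N k = var{x² = x₁x₂⋯x_k = 0, xy = yx}`. -/
def Nvar (k : ℕ) : ComVariety :=
  comVar ({commId} ∪ zeroId (wpow (ltr 0) 2) 1 ∪ zeroId (chainWord k) k)

/-- `N_ω = var{x² = 0, xy = yx}`. -/
def Nomegavar : ComVariety := comVar ({commId} ∪ zeroId (wpow (ltr 0) 2) 1)

/-- `N₃ᶜ = var{xyz = 0, xy = yx}`. -/
def N3cvar : ComVariety := comVar ({commId} ∪ zeroId (ltr 0 * ltr 1 * ltr 2) 3)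

/-! ### Semantic notions -/

/-- A semigroup `S` belongs to the variety `V` if it satisfies every identity of `V`. -/
def VMem (S : Type) [Semigroup S] (V : ComVariety) : Prop :=
  ∀ i ∈ V.theory, SGSatisfies S i

/-- `spow a n` is the power `aⁿ` in a semigroup (for `n ≥ 1`; by convention `spow a 0 = a`). -/
def spow {S : Type} [Semigroup S] (a : S) : ℕ → S
  | 0 => a
  | 1 => a
  | n + 2 => spow a (n + 1) * a

/-- A semigroup is a group. -/
def IsGroupSG (S : Type) [Semigroup S] : Prop :=
  ∃ e : S, (∀ a, e * a = a ∧ a * e = a) ∧ ∀ a, ∃ b, a * b = e ∧ b * a = e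

/-- A semigroup is periodic: every element generates a finite cyclic subsemigroup. -/
def IsPeriodicSG (S : Type) [Semigroup S] : Prop :=
  ∀ a : S, ∃ i j : ℕ, 1 ≤ i ∧ i < j ∧ spow a i = spow a j

/-- A semigroup is a nil-semigroup: it has a zero element and every element has a
power equal to zero. -/
def IsNilSG (S : Type) [Semigroup S] : Prop :=
  ∃ z : S, (∀ a, z * a = z ∧ a * z = z) ∧ ∀ a, ∃ n, 1 ≤ n ∧ spow a n = z

/-- A variety all of whose members are groups. -/
def IsGroupVariety (V : ComVariety) : Prop := ∀ S ∈ modelsOf V.theory, IsGroupSG S.carrier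

/-- A variety all of whose members are periodic semigroups. -/
def IsPeriodicVariety (V : ComVariety) : Prop := ∀ S ∈ modelsOf V.theory, IsPeriodicSG S.carrier

/-- A nil-variety: a variety all of whose members are nil-semigroups. -/
def IsNilVariety (V : ComVariety) : Prop := ∀ S ∈ modelsOf V.theory, IsNilSG S.carrier

/-- A combinatorial variety: all groups in it are trivial. -/
def IsCombinatorial (V : ComVariety) : Prop :=
  ∀ S ∈ modelsOf V.theory, IsGroupSG S.carrier → ∀ a b : S.carrier, a = b

/-- `K` is the variety generated by the semigroup `M` (with explicit semigroup
structure `inst`): the smallest variety containing `M`. -/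
def GeneratedBy (M : Type) (inst : Semigroup M) (K : ComVariety) : Prop :=
  IsLeast {W : ComVariety | ∀ i ∈ W.theory, @SGSatisfies M inst i} K

/-- A neutral element of a lattice. -/
def IsNeutralElt {α : Type*} [Lattice α] (x : α) : Prop :=
  ∀ y z, (x ⊔ y) ⊓ (y ⊔ z) ⊓ (z ⊔ x) = (x ⊓ y) ⊔ (y ⊓ z) ⊔ (z ⊓ x)

/-- A chain variety: a variety whose lattice of subvarieties is a chain. -/
def IsChainVariety (V : ComVariety) : Prop :=
  ∀ W₁ W₂ : ComVariety, W₁ ≤ V → W₂ ≤ V → W₁ ≤ W₂ ∨ W₂ ≤ W₁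

/-- A variety is 0-reduced in **Com** if it is given within `COM` by 0-reduced
identities (identities of the form `w = 0`) only. -/
def IsZeroReduced (V : ComVariety) : Prop :=
  ∃ P : Set (SGWord × ℕ), (∀ p ∈ P, ¬ OccursIn p.2 p.1) ∧
    V = comVar (⋃ p ∈ P, zeroId p.1 p.2)

/-- `ZR V`: the least variety 0-reduced in **Com** that contains `V`. -/
def ZRv (V : ComVariety) : ComVariety := sInf {W : ComVariety | IsZeroReduced W ∧ V ≤ W}

/-! ### Evaluating words -/

/-- The number of occurrences of the letter `x` in the word `u`. -/
def cnt (x : ℕ) (u : SGWord) : ℕ := (u.head :: u.tail).count x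

/-- The number of occurrences of letters other than `x` in the word `u`. -/
def oth (x : ℕ) (u : SGWord) : ℕ := (u.head :: u.tail).countP (· ≠ x)

theorem cnt_of (x y : ℕ) : cnt x (FreeSemigroup.of y) = if y = x then 1 else 0 := by
  simp [cnt, List.count_cons]

theorem cnt_mul (x : ℕ) (u v : SGWord) : cnt x (u * v) = cnt x u + cnt x v := by
  simp only [cnt, FreeSemigroup.head_mul, FreeSemigroup.tail_mul, ← List.cons_append,
    List.count_append]

theorem oth_of (x y : ℕ) : oth x (FreeSemigroup.of y) = if y = x then 0 else 1 := by
  by_cases h : y = x <;> simp [oth, h]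

theorem oth_mul (x : ℕ) (u v : SGWord) : oth x (u * v) = oth x u + oth x v := by
  simp only [oth, FreeSemigroup.head_mul, FreeSemigroup.tail_mul, ← List.cons_append,
    List.countP_append]

theorem cnt_head_pos (u : SGWord) : 1 ≤ cnt u.head u := by
  simp [cnt]

theorem one_le_cnt_add_oth (x : ℕ) (u : SGWord) : 1 ≤ cnt x u + oth x u := by
  induction u using FreeSemigroup.recOnMul with
  | ih1 y => rw [cnt_of, oth_of]; split <;> simp
  | ih2 y v h _ => rw [cnt_mul, oth_mul]; omega

theorem lift_ite {M : Type*} [CommMonoid M] (x : ℕ) (a b : M) (u : SGWord) :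
    FreeSemigroup.lift (fun y => if y = x then a else b) u = a ^ cnt x u * b ^ oth x u := by
  induction u using FreeSemigroup.recOnMul with
  | ih1 y => rw [FreeSemigroup.lift_of, cnt_of, oth_of]; split <;> simp
  | ih2 y v h1 h2 =>
    rw [map_mul, h1, h2, cnt_mul, oth_mul, pow_add, pow_add, mul_mul_mul_comm]

theorem exists_lift_eq_prod (u : SGWord) : ∃ N, ∀ N' ≥ N, ∀ {M : Type} [CommMonoid M]
    (f : ℕ → M), FreeSemigroup.lift f u = ∏ x ∈ Finset.range N', f x ^ cnt x u := by
  induction u using FreeSemigroup.recOnMul with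
  | ih1 y =>
    refine ⟨y + 1, fun N' hN M _ f => ?_⟩
    have hy : y ∈ Finset.range N' := Finset.mem_range.2 (by omega)
    simp [cnt_of, pow_ite, Finset.prod_ite_eq, hy]
  | ih2 y v h1 h2 =>
    obtain ⟨N1, h1⟩ := h1
    obtain ⟨N2, h2⟩ := h2
    refine ⟨max N1 N2, fun N' hN M _ f => ?_⟩
    rw [map_mul, h1 N' (le_trans (le_max_left _ _) hN), h2 N' (le_trans (le_max_right _ _) hN),
      ← Finset.prod_mul_distrib]
    exact Finset.prod_congr rfl fun x _ => by rw [cnt_mul, pow_add]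

theorem exists_lift_eq_prod₂ (u v : SGWord) (B : ℕ) : ∃ N ≥ B,
    ∀ {M : Type} [CommMonoid M] (f : ℕ → M),
    FreeSemigroup.lift f u = ∏ x ∈ Finset.range N, f x ^ cnt x u ∧
    FreeSemigroup.lift f v = ∏ x ∈ Finset.range N, f x ^ cnt x v := by
  obtain ⟨N1, h1⟩ := exists_lift_eq_prod u
  obtain ⟨N2, h2⟩ := exists_lift_eq_prod v
  exact ⟨max B (max N1 N2), by omega, fun f => ⟨h1 _ (by omega) f, h2 _ (by omega) f⟩⟩

theorem lift_eq_of_pow_eq {M : Type} [CommMonoid M] {f : ℕ → M} {u v : SGWord}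
    (h : ∀ x, f x ^ cnt x u = f x ^ cnt x v) :
    FreeSemigroup.lift f u = FreeSemigroup.lift f v := by
  obtain ⟨N, -, hN⟩ := exists_lift_eq_prod₂ u v 0
  rw [(hN f).1, (hN f).2]
  exact Finset.prod_congr rfl fun x _ => h x

theorem lift_comp {S T : Type*} [Semigroup S] [Semigroup T] (g : S →ₙ* T) (f : ℕ → S)
    (u : SGWord) : g (FreeSemigroup.lift f u) = FreeSemigroup.lift (fun n => g (f n)) u := by
  induction u using FreeSemigroup.recOnMul with
  | ih1 y => simp
  | ih2 y v h1 h2 => rw [map_mul, map_mul, map_mul, h1, h2]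

theorem coe_lift {S : Type*} [CommSemigroup S] (f : ℕ → S) (u : SGWord) :
    ((FreeSemigroup.lift f u : S) : WithOne S) =
      FreeSemigroup.lift (fun n => (f n : WithOne S)) u :=
  lift_comp WithOne.coeMulHom f u

theorem lift_lift {S : Type*} [Semigroup S] (f : ℕ → S) (g : ℕ → SGWord) (u : SGWord) :
    FreeSemigroup.lift f (FreeSemigroup.lift g u) =
      FreeSemigroup.lift (fun n => FreeSemigroup.lift f (g n)) u :=
  lift_comp (FreeSemigroup.lift f) g u

theorem lift_wpow {M : Type*} [Monoid M] (f : ℕ → M) (w : SGWord) {k : ℕ} (hk : 1 ≤ k) :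
    FreeSemigroup.lift f (wpow w k) = FreeSemigroup.lift f w ^ k := by
  induction k, hk using Nat.le_induction with
  | base => simp [wpow]
  | succ k hk ih =>
    obtain ⟨k, rfl⟩ := Nat.exists_eq_succ_of_ne_zero (by omega : k ≠ 0)
    rw [wpow, map_mul, ih, ← pow_succ]

theorem cnt_wpow (x : ℕ) (w : SGWord) {k : ℕ} (hk : 1 ≤ k) :
    cnt x (wpow w k) = k * cnt x w := by
  induction k, hk using Nat.le_induction with
  | base => simp [wpow]
  | succ k hk ih =>
    obtain ⟨k, rfl⟩ := Nat.exists_eq_succ_of_ne_zero (by omega : k ≠ 0)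
    rw [wpow, cnt_mul, ih]; ring

theorem oth_wpow (x : ℕ) (w : SGWord) {k : ℕ} (hk : 1 ≤ k) :
    oth x (wpow w k) = k * oth x w := by
  induction k, hk using Nat.le_induction with
  | base => simp [wpow]
  | succ k hk ih =>
    obtain ⟨k, rfl⟩ := Nat.exists_eq_succ_of_ne_zero (by omega : k ≠ 0)
    rw [wpow, oth_mul, ih]; ring

/-- There is a word representing `xⁱyʲ` in every commutative monoid. -/
theorem exists_word (i j : ℕ) (h : 1 ≤ i + j) : ∃ w : SGWord, ∀ {M : Type} [CommMonoid M]
    (f : ℕ → M), FreeSemigroup.lift f w = f 0 ^ i * f 1 ^ j := by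
  rcases Nat.eq_zero_or_pos i with rfl | hi
  · exact ⟨wpow (ltr 1) j, fun f => by rw [lift_wpow f _ (by omega)]; simp [ltr]⟩
  rcases Nat.eq_zero_or_pos j with rfl | hj
  · exact ⟨wpow (ltr 0) i, fun f => by rw [lift_wpow f _ hi]; simp [ltr]⟩
  · exact ⟨wpow (ltr 0) i * wpow (ltr 1) j, fun f => by
      rw [map_mul, lift_wpow f _ hi, lift_wpow f _ hj]; simp [ltr]⟩

/-! ### Models and identities in at most two letters -/

namespace ComVariety

/-- The members of the variety `V`. -/
abbrev Mod (V : ComVariety) : Set ComSG := modelsOf V.theory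

theorem mem_theory_iff {V : ComVariety} {i : SGId} :
    i ∈ V.theory ↔ ∀ S ∈ V.Mod, SGSatisfies S.carrier i := by
  conv_lhs => rw [← V.closed]
  rfl

theorem le_def {V W : ComVariety} : V ≤ W ↔ W.theory ⊆ V.theory := Iff.rfl

/-- The variety generated by `S`. -/
def gen (S : ComSG) : ComVariety where
  theory := theoryOfClass {S}
  closed := by
    apply subset_antisymm
    · exact theoryOfClass_antitone fun T hT i hi => hi T hT
    · exact subset_theoryOfClass_modelsOf _

theorem mem_gen_theory {S : ComSG} {i : SGId} :
    i ∈ (gen S).theory ↔ SGSatisfies S.carrier i := by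
  simp [gen, theoryOfClass]

theorem gen_le_iff {S : ComSG} {V : ComVariety} : gen S ≤ V ↔ S ∈ V.Mod :=
  ⟨fun h _ hi => mem_gen_theory.1 (h hi), fun h _ hi => mem_gen_theory.2 (h _ hi)⟩

theorem self_mem_gen (S : ComSG) : S ∈ (gen S).Mod := gen_le_iff.1 le_rfl

theorem mod_mono {V W : ComVariety} (h : V ≤ W) : V.Mod ⊆ W.Mod := modelsOf_antitone h

theorem inter_subset_sup_theory (V W : ComVariety) :
    V.theory ∩ W.theory ⊆ (V ⊔ W).theory := by
  rintro i ⟨hV, hW⟩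
  have h : V ⊔ W ≤ ⟨theoryOfClass (V.Mod ∪ W.Mod), subset_antisymm
      (theoryOfClass_antitone fun S hS i hi => hi S hS) (subset_theoryOfClass_modelsOf _)⟩ :=
    sup_le (fun i hi => mem_theory_iff.2 fun S hS => hi S (Or.inl hS))
      (fun i hi => mem_theory_iff.2 fun S hS => hi S (Or.inr hS))
  refine h ?_
  rintro S (hS | hS)
  exacts [hS i hV, hS i hW]

theorem comVar_le {E : Set SGId} {V : ComVariety} : V ≤ comVar E ↔ E ⊆ V.theory := by
  constructor
  · exact fun h => (subset_theoryOfClass_modelsOf E).trans h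
  · intro h i hi
    exact mem_theory_iff.2 fun S hS => hi S fun j hj => hS j (h hj)

theorem comm_mem (V : ComVariety) : commId ∈ V.theory :=
  mem_theory_iff.2 fun S _ f => by simp [commId, mul_comm]

/-- `V` satisfies the identity `xⁱyʲ = xᵏyˡ`. -/
def Two (V : ComVariety) (i j k l : ℕ) : Prop :=
  ∀ S ∈ V.Mod, ∀ a b : S.carrier,
    (a : WithOne S.carrier) ^ i * (b : WithOne S.carrier) ^ j = a ^ k * b ^ l

/-- `V` satisfies the identity `xˢ = xᵗ`. -/
def Pow (V : ComVariety) (s t : ℕ) : Prop :=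
  ∀ S ∈ V.Mod, ∀ a : S.carrier, (a : WithOne S.carrier) ^ s = a ^ t

theorem two_of_mem {V : ComVariety} {u v : SGWord} (h : (u, v) ∈ V.theory) (x : ℕ) :
    V.Two (cnt x u) (oth x u) (cnt x v) (oth x v) := by
  intro S hS a b
  have := congrArg (fun s : S.carrier => (s : WithOne S.carrier))
    (hS _ h fun y => if y = x then a else b)
  simp only [coe_lift, apply_ite] at this
  rwa [lift_ite, lift_ite] at this

theorem exists_coe_eq_pow {S : Type} [CommSemigroup S] (a : S) {r : ℕ} (hr : 1 ≤ r) :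
    ∃ b : S, (b : WithOne S) = a ^ r := by
  induction r, hr using Nat.le_induction with
  | base => exact ⟨a, by simp⟩
  | succ r _ ih =>
    obtain ⟨b, hb⟩ := ih
    exact ⟨b * a, by rw [WithOne.coe_mul, hb, pow_succ]⟩

theorem Two.pow_right {V : ComVariety} {i j k l : ℕ} (h : V.Two i j k l) {r : ℕ} (hr : 1 ≤ r) :
    V.Two i (r * j) k (r * l) := by
  intro S hS a b
  obtain ⟨b', hb⟩ := exists_coe_eq_pow b hr
  have := h S hS a b'
  rwa [hb, ← pow_mul, ← pow_mul] at this

theorem Two.pow {V : ComVariety} {i j k l : ℕ} (h : V.Two i j k l) {r : ℕ} (hr : 1 ≤ r) :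
    V.Pow (i + r * j) (k + r * l) := by
  intro S hS a
  have := h.pow_right hr S hS a a
  rwa [← pow_add, ← pow_add] at this

theorem exists_words (i j k l : ℕ) (hij : 1 ≤ i + j) (hkl : 1 ≤ k + l) : ∃ w w' : SGWord,
    (∀ {M : Type} [CommMonoid M] (f : ℕ → M), FreeSemigroup.lift f w = f 0 ^ i * f 1 ^ j) ∧
    (∀ {M : Type} [CommMonoid M] (f : ℕ → M), FreeSemigroup.lift f w' = f 0 ^ k * f 1 ^ l) ∧
    ∀ V : ComVariety, (w, w') ∈ V.theory ↔ V.Two i j k l := by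
  obtain ⟨w, hw⟩ := exists_word i j hij
  obtain ⟨w', hw'⟩ := exists_word k l hkl
  refine ⟨w, w', hw, hw', fun V => ?_⟩
  rw [mem_theory_iff]
  constructor
  · intro h S hS a b
    have := congrArg (fun s : S.carrier => (s : WithOne S.carrier))
      (h S hS fun y => if y = 0 then a else b)
    simp only [coe_lift] at this
    rw [hw, hw'] at this
    simpa using this
  · intro h S hS f
    have := h S hS (f 0) (f 1)
    apply WithOne.coe_injective
    simp only [coe_lift]
    rw [hw, hw', this]

theorem pow_iff_two {V : ComVariety} {s t : ℕ} : V.Pow s t ↔ V.Two s 0 t 0 := by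
  simp only [Pow, Two, pow_zero, mul_one]
  exact ⟨fun h S hS a _ => h S hS a, fun h S hS a => h S hS a a⟩

theorem two_gen {S : ComSG} {i j k l : ℕ} (hij : 1 ≤ i + j) (hkl : 1 ≤ k + l) :
    (gen S).Two i j k l ↔ ∀ a b : S.carrier,
      (a : WithOne S.carrier) ^ i * (b : WithOne S.carrier) ^ j = a ^ k * b ^ l := by
  refine ⟨fun h => h S (self_mem_gen S), fun h => ?_⟩
  obtain ⟨w, w', hw, hw', hV⟩ := exists_words i j k l hij hkl
  rw [← hV, mem_gen_theory]
  intro f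
  apply WithOne.coe_injective
  simp only [coe_lift]
  rw [hw, hw', h]

theorem two_sup {V W : ComVariety} {i j k l : ℕ} (hij : 1 ≤ i + j) (hkl : 1 ≤ k + l)
    (hV : V.Two i j k l) (hW : W.Two i j k l) : (V ⊔ W).Two i j k l := by
  obtain ⟨w, w', -, -, h⟩ := exists_words i j k l hij hkl
  exact (h _).1 (inter_subset_sup_theory V W ⟨(h V).2 hV, (h W).2 hW⟩)

theorem Pow.mono {V W : ComVariety} {s t : ℕ} (h : V ≤ W) (hW : W.Pow s t) :
    V.Pow s t := fun S hS => hW S (mod_mono h hS)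

/-- A monoid in `V` satisfies the two-letter identities of `V` for all exponents, including zero. -/
theorem Two.eval {V : ComVariety} {i j k l : ℕ} (h : V.Two i j k l) {M : Type} [CommMonoid M]
    (hM : (⟨M⟩ : ComSG) ∈ V.Mod) (a b : M) : a ^ i * b ^ j = a ^ k * b ^ l := by
  have := congrArg (WithOne.lift (MulHom.id M)) (h _ hM a b)
  simpa using this

theorem two_gen_monoid {M : Type} [CommMonoid M] {i j k l : ℕ} (hij : 1 ≤ i + j)
    (hkl : 1 ≤ k + l) (h : ∀ a b : M, a ^ i * b ^ j = a ^ k * b ^ l) :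
    (gen ⟨M⟩).Two i j k l := by
  obtain ⟨w, w', hw, hw', hV⟩ := exists_words i j k l hij hkl
  rw [← hV, mem_gen_theory]
  intro f
  exact (hw f).trans ((h _ _).trans (hw' f).symm)

theorem Pow.eval {V : ComVariety} {s t : ℕ} (h : V.Pow s t) {M : Type} [CommMonoid M]
    (hM : (⟨M⟩ : ComSG) ∈ V.Mod) (a : M) : a ^ s = a ^ t := by
  simpa using (pow_iff_two.1 h).eval hM a a

theorem pow_gen_monoid {M : Type} [CommMonoid M] {s t : ℕ} (hs : 1 ≤ s) (ht : 1 ≤ t)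
    (h : ∀ a : M, a ^ s = a ^ t) : (gen ⟨M⟩).Pow s t :=
  pow_iff_two.2 (two_gen_monoid (by omega) (by omega) fun a b => by simpa using h a)

/-! ### Periods -/

theorem Pow.symm {V : ComVariety} {s t : ℕ} (h : V.Pow s t) : V.Pow t s :=
  fun S hS a => (h S hS a).symm

theorem Pow.trans {V : ComVariety} {r s t : ℕ} (h : V.Pow r s) (h' : V.Pow s t) : V.Pow r t :=
  fun S hS a => (h S hS a).trans (h' S hS a)

theorem Pow.add {V : ComVariety} {s t s' t' : ℕ} (h : V.Pow s t) (h' : V.Pow s' t') :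
    V.Pow (s + s') (t + t') := fun S hS a => by
  rw [pow_add, pow_add, h S hS a, h' S hS a]

theorem Pow.refl (V : ComVariety) (s : ℕ) : V.Pow s s := fun _ _ _ => rfl

theorem Pow.iterate {V : ComVariety} {t d : ℕ} (h : V.Pow t (t + d)) {n : ℕ} (hn : t ≤ n)
    (j : ℕ) : V.Pow n (n + j * d) := by
  induction j with
  | zero => simpa using Pow.refl V n
  | succ j ih =>
    refine ih.trans ?_
    have := h.add (Pow.refl V (n - t + j * d))
    convert this using 1
    · omega
    · rw [add_mul]; omega

/-- The group of differences `s - t` over all identities `xˢ = xᵗ` of `V`. -/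
def periods (V : ComVariety) : AddSubgroup ℤ where
  carrier := {z | ∃ s t : ℕ, z = s - t ∧ V.Pow s t}
  zero_mem' := ⟨0, 0, by simp, Pow.refl V 0⟩
  add_mem' := by
    rintro _ _ ⟨s, t, rfl, h⟩ ⟨s', t', rfl, h'⟩
    exact ⟨s + s', t + t', by push_cast; ring, h.add h'⟩
  neg_mem' := by
    rintro _ ⟨s, t, rfl, h⟩
    exact ⟨t, s, by ring, h.symm⟩

theorem exists_period (V : ComVariety) : ∃ d : ℕ, (∃ t, V.Pow t (t + d)) ∧
    ∀ s t, V.Pow s t → (d : ℤ) ∣ (s : ℤ) - t := by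
  obtain ⟨z, hz⟩ := Int.subgroup_cyclic V.periods
  have hmem : ∀ y, y ∈ V.periods ↔ z ∣ y := by
    intro y
    rw [hz, AddSubgroup.mem_closure_singleton]
    exact ⟨fun ⟨n, hn⟩ => ⟨n, by rw [← hn]; simp [mul_comm]⟩,
      fun ⟨n, hn⟩ => ⟨n, by rw [hn]; simp [mul_comm]⟩⟩
  refine ⟨z.natAbs, ?_, fun s t h => Int.natAbs_dvd.2 ((hmem _).1 ⟨s, t, rfl, h⟩)⟩
  obtain ⟨s, t, hst, h⟩ := (hmem (z.natAbs : ℤ)).2 (by simp)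
  refine ⟨t, ?_⟩
  have : s = t + z.natAbs := by omega
  exact this ▸ h.symm

end ComVariety

/-! ### The generating semigroups -/

/-- The cyclic monoid `⟨a ∣ aᵐ = aᵐ⁺¹⟩`, with `aⁱ` represented by `i`. -/
def TruncMon (m : ℕ) : Type := Fin (m + 1)

namespace TruncMon

variable {m : ℕ}

/-- The element `aⁱ` of the cyclic monoid. -/
def mk (m i : ℕ) : TruncMon m := ⟨min m i, by omega⟩

/-- The exponent of an element of the cyclic monoid. -/
def exp (a : TruncMon m) : ℕ := Fin.val a

theorem exp_le (a : TruncMon m) : a.exp ≤ m := Nat.lt_succ_iff.1 (Fin.is_lt a)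

theorem exp_mk (i : ℕ) : (mk m i).exp = min m i := rfl

theorem exp_injective : Function.Injective (exp : TruncMon m → ℕ) := Fin.val_injective

instance : CommMonoid (TruncMon m) where
  mul a b := mk m (a.exp + b.exp)
  one := mk m 0
  mul_assoc a b c := exp_injective (by
    change min m (min m (a.exp + b.exp) + c.exp) = min m (a.exp + min m (b.exp + c.exp)); omega)
  mul_comm a b := exp_injective (by
    change min m (a.exp + b.exp) = min m (b.exp + a.exp); omega)
  one_mul a := exp_injective (by
    change min m (min m 0 + a.exp) = a.exp
    have := a.exp_le; omega)
  mul_one a := exp_injective (by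
    change min m (a.exp + min m 0) = a.exp
    have := a.exp_le; omega)

theorem exp_one : (1 : TruncMon m).exp = 0 := min_eq_right (Nat.zero_le m)

theorem exp_mul (a b : TruncMon m) : (a * b).exp = min m (a.exp + b.exp) := rfl

theorem exp_pow (a : TruncMon m) (k : ℕ) : (a ^ k).exp = min m (k * a.exp) := by
  induction k with
  | zero => simp [exp_one]
  | succ k ih => rw [pow_succ, exp_mul, ih, add_mul, one_mul]; omega

theorem pow_eq_pow {k l : ℕ} (h : k = l ∨ m ≤ k ∧ m ≤ l) (a : TruncMon m) : a ^ k = a ^ l := by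
  rcases h with rfl | ⟨hk, hl⟩
  · rfl
  apply exp_injective
  rw [exp_pow, exp_pow]
  rcases Nat.eq_zero_or_pos a.exp with h | h
  · simp [h]
  · rw [min_eq_left (hk.trans (Nat.le_mul_of_pos_right k h)),
      min_eq_left (hl.trans (Nat.le_mul_of_pos_right l h))]

theorem of_pow_mul_pow_eq {i j k l : ℕ} (h : mk m 1 ^ i * 1 ^ j = mk m 1 ^ k * 1 ^ l) :
    i = k ∨ m ≤ i ∧ m ≤ k := by
  rw [one_pow, one_pow, mul_one, mul_one] at h
  have := congrArg exp h
  rw [exp_pow, exp_pow, exp_mk] at this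
  rcases m with - | m
  · omega
  · rw [min_eq_right (by omega : 1 ≤ m + 1)] at this
    omega

end TruncMon

/-- The monogenic nil-semigroup `⟨a ∣ aᵏ⁺¹ = 0⟩`, with `aⁱ⁺¹` represented by `i`. -/
def NilCyc (k : ℕ) : Type := Fin (k + 1)

namespace NilCyc

variable {k : ℕ}

theorem val_injective : Function.Injective (Fin.val : NilCyc k → ℕ) := Fin.val_injective

instance : CommSemigroup (NilCyc k) where
  mul a b := ⟨min k (Fin.val a + Fin.val b + 1), by omega⟩
  mul_assoc a b c := val_injective (by
    change min k (min k (a.val + b.val + 1) + c.val + 1) =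
      min k (a.val + min k (b.val + c.val + 1) + 1)
    omega)
  mul_comm a b := val_injective (by
    change min k (a.val + b.val + 1) = min k (b.val + a.val + 1); omega)

theorem val_mul (a b : NilCyc k) : Fin.val (a * b) = min k (Fin.val a + Fin.val b + 1) := rfl

instance : Nonempty (NilCyc k) := inferInstanceAs (Nonempty (Fin (k + 1)))

theorem pow_eq_coe (a : NilCyc k) (n : ℕ) : ∃ b : NilCyc k,
    (a : WithOne (NilCyc k)) ^ (n + 1) = b ∧ Fin.val b = min k (n + (n + 1) * Fin.val a) := by
  induction n with
  | zero =>
    have := Fin.is_lt a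
    exact ⟨a, by simp, by simp; omega⟩
  | succ n ih =>
    obtain ⟨b, hb, hv⟩ := ih
    refine ⟨b * a, by rw [pow_succ, hb, WithOne.coe_mul], ?_⟩
    rw [val_mul, hv, add_mul (n + 1)]; omega

theorem pow_eq_pow (a b : NilCyc k) {m n : ℕ} (hm : k + 1 ≤ m) (hn : k + 1 ≤ n) :
    (a : WithOne (NilCyc k)) ^ m = b ^ n := by
  obtain ⟨m, rfl⟩ := Nat.exists_eq_add_of_le' (by omega : 1 ≤ m)
  obtain ⟨n, rfl⟩ := Nat.exists_eq_add_of_le' (by omega : 1 ≤ n)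
  obtain ⟨c, hc, hcv⟩ := pow_eq_coe a m
  obtain ⟨d, hd, hdv⟩ := pow_eq_coe b n
  rw [hc, hd, WithOne.coe_inj]
  apply val_injective
  rw [hcv, hdv]; omega

theorem of_pow_eq_pow {m n : ℕ}
    (h : (show NilCyc k from (0 : Fin (k + 1)) : WithOne (NilCyc k)) ^ (m + 1) =
      (show NilCyc k from (0 : Fin (k + 1)) : WithOne (NilCyc k)) ^ (n + 1)) :
    min k m = min k n := by
  obtain ⟨c, hc, hcv⟩ := pow_eq_coe (k := k) (0 : Fin (k + 1)) m
  obtain ⟨d, hd, hdv⟩ := pow_eq_coe (k := k) (0 : Fin (k + 1)) n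
  have h2 : c = d := WithOne.coe_inj.1 (hc.symm.trans (h.trans hd))
  simpa [h2, hdv] using hcv.symm

end NilCyc

namespace ComVariety

/-- The variety generated by the cyclic group of order `d`. -/
def cyc (d : ℕ) : ComVariety := gen ⟨Multiplicative (ZMod d)⟩

/-- The variety generated by the cyclic monoid `⟨a ∣ aᵐ = aᵐ⁺¹⟩`. -/
def mon (m : ℕ) : ComVariety := gen ⟨TruncMon m⟩

/-- The variety generated by the monogenic nil-semigroup `⟨a ∣ aᵏ⁺¹ = 0⟩`. -/
def nilCyc (k : ℕ) : ComVariety := gen ⟨NilCyc k⟩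

theorem Pow.dvd_of_cyc_le {V : ComVariety} {d s t : ℕ} (h : V.Pow s t) (hd : cyc d ≤ V) :
    (d : ℤ) ∣ (s : ℤ) - t := by
  have := h.eval (gen_le_iff.1 hd) (Multiplicative.ofAdd 1)
  rw [← ofAdd_nsmul, ← ofAdd_nsmul, Multiplicative.ofAdd.injective.eq_iff, nsmul_one,
    nsmul_one] at this
  exact Nat.modEq_iff_dvd.1 ((ZMod.natCast_eq_natCast_iff t s d).1 this.symm)

theorem cyc_pow_eq {d s t : ℕ} (h : (d : ℤ) ∣ (s : ℤ) - t) (a : Multiplicative (ZMod d)) :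
    a ^ s = a ^ t := by
  apply Multiplicative.toAdd.injective
  rw [toAdd_pow, toAdd_pow, nsmul_eq_mul, nsmul_eq_mul,
    (ZMod.natCast_eq_natCast_iff s t d).2 ((Nat.modEq_iff_dvd).2 (dvd_sub_comm.1 h))]

theorem cnt_dvd_of_forall_pow {V : ComVariety} {d : ℕ} (hd : 1 ≤ d)
    (h : ∀ s t, V.Pow s t → (d : ℤ) ∣ (s : ℤ) - t) {u v : SGWord} (huv : (u, v) ∈ V.theory)
    (x : ℕ) : (d : ℤ) ∣ (cnt x u : ℤ) - cnt x v := by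
  have h1 := h _ _ ((two_of_mem huv x).pow hd)
  have h2 : (d : ℤ) ∣ (d : ℤ) * (oth x v - oth x u) := dvd_mul_right _ _
  have h3 : (cnt x u : ℤ) - cnt x v = ((cnt x u + d * oth x u : ℕ) : ℤ) -
      (cnt x v + d * oth x v : ℕ) + d * (oth x v - oth x u) := by push_cast; ring
  exact h3 ▸ dvd_add h1 h2

theorem cyc_le_of_forall_pow {V : ComVariety} {d : ℕ} (hd : 1 ≤ d)
    (h : ∀ s t, V.Pow s t → (d : ℤ) ∣ (s : ℤ) - t) : cyc d ≤ V := by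
  rintro ⟨u, v⟩ huv
  refine mem_gen_theory.2 fun f => ?_
  exact lift_eq_of_pow_eq (M := Multiplicative (ZMod d))
    fun x => cyc_pow_eq (cnt_dvd_of_forall_pow hd h huv x) _

theorem cyc_two {d n : ℕ} (hn : 1 ≤ n) (h : d ∣ n) : (cyc d).Two n 0 0 n := by
  have h1 (a : Multiplicative (ZMod d)) : a ^ n = 1 := by
    rw [cyc_pow_eq (t := 0) (by simpa using Int.natCast_dvd_natCast.2 h), pow_zero]
  exact two_gen_monoid (by omega) (by omega) fun a b => by rw [h1, h1, pow_zero, pow_zero]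

theorem cyc_pow {d s t : ℕ} (hs : 1 ≤ s) (ht : 1 ≤ t) (h : (d : ℤ) ∣ (s : ℤ) - t) :
    (cyc d).Pow s t := pow_gen_monoid hs ht fun a => cyc_pow_eq h a

theorem nilCyc_two {k n : ℕ} (hn : k + 1 ≤ n) : (nilCyc k).Two n 0 0 n :=
  (two_gen (by omega) (by omega)).2 fun a b => by
    simpa using NilCyc.pow_eq_pow a b hn hn

theorem nilCyc_pow {k s t : ℕ} (hs : k + 1 ≤ s) (ht : k + 1 ≤ t) : (nilCyc k).Pow s t :=
  pow_iff_two.2 ((two_gen (by omega) (by omega)).2 fun a b => by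
    simpa using NilCyc.pow_eq_pow a a hs ht)

theorem Pow.min_eq_of_nilCyc_le {V : ComVariety} {k s t : ℕ} (h : V.Pow (s + 1) (t + 1))
    (hk : nilCyc k ≤ V) : min k s = min k t :=
  NilCyc.of_pow_eq_pow (h _ (gen_le_iff.1 hk) _)

theorem Two.of_mon_le {V : ComVariety} {m i j k l : ℕ} (h : V.Two i j k l) (hm : mon m ≤ V) :
    i = k ∨ m ≤ i ∧ m ≤ k :=
  TruncMon.of_pow_mul_pow_eq (h.eval (gen_le_iff.1 hm) (TruncMon.mk m 1) 1)

theorem mon_le_iff {V : ComVariety} {m : ℕ} : mon m ≤ V ↔ ∀ u v, (u, v) ∈ V.theory →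
    ∀ x, cnt x u = cnt x v ∨ m ≤ cnt x u ∧ m ≤ cnt x v := by
  refine ⟨fun h u v huv x => (two_of_mem huv x).of_mon_le h, ?_⟩
  rintro h ⟨u, v⟩ huv
  refine mem_gen_theory.2 fun f => ?_
  exact lift_eq_of_pow_eq (M := TruncMon m) fun x => TruncMon.pow_eq_pow (h u v huv x) _

theorem le_mon_of_pow {V : ComVariety} {m : ℕ} (h : V.Pow m (m + 1)) : V ≤ mon m := by
  rintro ⟨u, v⟩ huv
  rw [mem_theory_iff]
  intro S hS f
  apply WithOne.coe_injective
  simp only [coe_lift]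
  refine lift_eq_of_pow_eq fun x => ?_
  rcases mon_le_iff.1 le_rfl u v huv x with h1 | ⟨h1, h2⟩
  · rw [h1]
  · have key : ∀ n ≥ m, V.Pow m n := fun n hn => by
      have := h.iterate le_rfl (n - m)
      rwa [mul_one, Nat.add_sub_cancel' hn] at this
    rw [← key _ h1 S hS, key _ h2 S hS]

theorem mon_pow {m s t : ℕ} (hs : 1 ≤ s) (ht : 1 ≤ t) (hs' : m ≤ s) (ht' : m ≤ t) :
    (mon m).Pow s t := pow_gen_monoid hs ht fun a => TruncMon.pow_eq_pow (Or.inr ⟨hs', ht'⟩) a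

theorem Pow.le_of_mon_le {V : ComVariety} {k s t : ℕ} (h : V.Pow s t) (hst : s ≠ t)
    (hk : mon k ≤ V) : k ≤ s := by
  have := (pow_iff_two.1 h).of_mon_le hk
  omega

theorem mon_le_mon {k l : ℕ} (hl : 1 ≤ l) : mon k ≤ mon l ↔ k ≤ l := by
  constructor
  · exact fun h => (mon_pow hl (by omega) le_rfl (Nat.le_succ l)).le_of_mon_le (by omega) h
  · intro h
    rw [mon_le_iff]
    intro u v huv x
    rcases mon_le_iff.1 le_rfl u v huv x with h1 | ⟨h1, h2⟩
    · exact Or.inl h1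
    · exact Or.inr ⟨by omega, by omega⟩

theorem eq_bot_of_letters {V : ComVariety} {x y : ℕ} (hxy : x ≠ y)
    (h : (ltr x, ltr y) ∈ V.theory) : V = ⊥ := by
  refine le_bot_iff.1 fun i _ => mem_theory_iff.2 fun S hS f => ?_
  have : ∀ a b : S.carrier, a = b := fun a b => by
    have := hS _ h fun z => if z = x then a else b
    simpa [ltr, hxy.symm] using this
  exact this _ _

theorem cvar_zero : Cvar 0 = ⊥ :=
  eq_bot_of_letters zero_ne_one (subset_theoryOfClass_modelsOf _ (Set.mem_singleton _))

theorem cvar_eq_mon (m : ℕ) : Cvar m = mon m := by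
  rcases m with - | m
  · refine le_antisymm (cvar_zero.trans_le bot_le) ?_
    rw [mon_le_iff]
    simp
  · have hw (f : ℕ → TruncMon (m + 1)) : FreeSemigroup.lift f (wpow (ltr 0) (m + 1)) =
        FreeSemigroup.lift f (wpow (ltr 0) (m + 2)) := by
      rw [lift_wpow f _ (by omega), lift_wpow f _ (by omega)]
      exact TruncMon.pow_eq_pow (Or.inr ⟨le_rfl, by omega⟩) _
    apply le_antisymm
    · apply le_mon_of_pow
      intro S hS a
      have := congrArg (fun s : S.carrier => (s : WithOne S.carrier))
        (hS _ (subset_theoryOfClass_modelsOf _ (Set.mem_insert _ _)) fun _ => a)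
      simp only [coe_lift] at this
      rw [lift_wpow _ _ (by omega), lift_wpow _ _ (by omega)] at this
      simpa [ltr] using this
    · rw [Cvar, comVar_le]
      rintro i (rfl | rfl)
      · exact mem_gen_theory.2 hw
      · exact comm_mem _

end ComVariety

/-! ### The variety of semilattices -/

namespace ComVariety

theorem eq_bot_of_forall_eq {V : ComVariety} (h : ∀ S ∈ V.Mod, ∀ a b : S.carrier, a = b) :
    V = ⊥ :=
  le_bot_iff.1 fun _ _ => mem_theory_iff.2 fun S hS _ => h S hS _ _

theorem exists_pow_of_forall_not_cyc_le {V : ComVariety}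
    (h : ∀ p : ℕ, p.Prime → ¬ cyc p ≤ V) : ∃ t, V.Pow t (t + 1) := by
  obtain ⟨d, ⟨t, ht⟩, hd⟩ := V.exists_period
  by_cases h1 : d = 1
  · exact ⟨t, h1 ▸ ht⟩
  · obtain ⟨p, hp, hpd⟩ := Nat.exists_prime_and_dvd h1
    exact absurd (cyc_le_of_forall_pow hp.one_lt.le fun s t hst =>
      (Int.natCast_dvd_natCast.2 hpd).trans (hd s t hst)) (h p hp)

theorem exists_pow_of_not_nilCyc_le {V : ComVariety} (h : ¬ nilCyc 1 ≤ V) :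
    ∃ e ≥ 1, V.Pow 1 (1 + e) := by
  have letter : ∀ (x : ℕ) (v : SGWord), (FreeSemigroup.of x, v) ∈ V.theory →
      v ≠ FreeSemigroup.of x → ∃ e ≥ 1, V.Pow 1 (1 + e) := by
    intro x v hv hne
    induction v using FreeSemigroup.recOnMul with
    | ih1 y =>
      have hxy : x ≠ y := fun hxy => hne (hxy ▸ rfl)
      rw [eq_bot_of_letters hxy hv]
      exact ⟨1, le_rfl, (mon_pow le_rfl (by omega) (Nat.zero_le _) (Nat.zero_le _)).mono
        (bot_le (a := mon 0))⟩
    | ih2 y w =>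
      refine ⟨oth x w + cnt x w, by have := one_le_cnt_add_oth x w; omega, ?_⟩
      have := (two_of_mem hv x).pow le_rfl
      simp only [cnt_of, oth_of, cnt_mul, oth_mul] at this
      convert this using 1
      · simp
      · split <;> omega
  rw [le_def, Set.not_subset] at h
  obtain ⟨⟨u, v⟩, huv, h⟩ := h
  rw [nilCyc, mem_gen_theory] at h
  have hmul : ∀ a b c d : NilCyc 1, a * b = c * d := fun a b c d =>
    NilCyc.val_injective (by rw [NilCyc.val_mul, NilCyc.val_mul]; omega)
  have hne : u ≠ v := fun huv => h fun f => by rw [huv]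
  induction u using FreeSemigroup.recOnMul with
  | ih1 x => exact letter x v huv hne.symm
  | ih2 x u =>
    induction v using FreeSemigroup.recOnMul with
    | ih1 y => exact letter y _ (mem_theory_iff.2 fun S hS f => (hS _ huv f).symm) hne
    | ih2 y v => exact absurd (fun f => by
        simp only [map_mul]
        exact hmul _ _ _ _) h

theorem pow_one_two {V : ComVariety} (h : ∀ p : ℕ, p.Prime → ¬ cyc p ≤ V)
    (h' : ¬ nilCyc 1 ≤ V) : V.Pow 1 2 := by
  obtain ⟨t, ht⟩ := exists_pow_of_forall_not_cyc_le h
  obtain ⟨e, he, hpow⟩ := exists_pow_of_not_nilCyc_le h'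
  have h1 := hpow.iterate le_rfl t
  have hle : t ≤ 1 + t * e := by nlinarith
  have h2 := ht.iterate hle 1
  rw [one_mul] at h2
  exact (h1.trans h2).trans (h1.add (Pow.refl V 1)).symm

theorem eq_bot_of_not_mon_one_le {V : ComVariety} (h : ¬ mon 1 ≤ V) (hV : V.Pow 1 2) :
    V = ⊥ := by
  have hpow : ∀ k ≥ 1, V.Pow k 1 := fun k hk => by
    have := Pow.iterate (t := 1) (d := 1) hV le_rfl (k - 1)
    rw [mul_one, Nat.add_sub_cancel' hk] at this
    exact this.symm
  have key : ∀ j k l, 1 ≤ k → V.Two 0 j k l → V = ⊥ := by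
    intro j k l hk h
    have hb : ∀ S ∈ V.Mod, ∀ a b : S.carrier, b = a * b := by
      intro S hS a b
      apply WithOne.coe_injective
      have := congrArg (· * (b : WithOne S.carrier)) (h S hS a b)
      simp only [pow_zero, one_mul, mul_assoc, ← pow_succ] at this
      rwa [hpow (j + 1) (by omega) S hS, hpow k hk S hS, hpow (l + 1) (by omega) S hS, pow_one,
        pow_one, ← WithOne.coe_mul] at this
    exact eq_bot_of_forall_eq fun S hS a b => by
      rw [hb S hS b a, mul_comm, ← hb S hS a b]
  rw [mon_le_iff] at h
  push Not at h
  obtain ⟨u, v, huv, x, hne, h⟩ := h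
  have h1 := two_of_mem huv x
  rcases Nat.eq_zero_or_pos (cnt x u) with h0 | h0
  · rw [h0] at h1
    exact key _ _ _ (by omega) h1
  · have h0' : cnt x v = 0 := by have := h h0; omega
    rw [h0'] at h1
    exact key _ _ _ h0 fun S hS a b => (h1 S hS a b).symm

theorem exists_le_of_ne_bot {V : ComVariety} (h : V ≠ ⊥) :
    (∃ p : ℕ, p.Prime ∧ cyc p ≤ V) ∨ nilCyc 1 ≤ V ∨ mon 1 ≤ V := by
  by_contra hcon
  push Not at hcon
  exact h (eq_bot_of_not_mon_one_le hcon.2.2 (pow_one_two hcon.1 hcon.2.1))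

theorem not_mon_one_le {V : ComVariety} {n : ℕ} (hn : 1 ≤ n) (h : V.Two n 0 0 n) :
    ¬ mon 1 ≤ V := fun hle => by
  have := h.of_mon_le hle
  omega

theorem not_cyc_le {V : ComVariety} {n p : ℕ} (hp : p.Prime) (h : V.Pow n (n + 1)) :
    ¬ cyc p ≤ V := fun hle => by
  have h1 := h.dvd_of_cyc_le hle
  rw [Nat.cast_succ, sub_add_cancel_left, Int.dvd_neg] at h1
  exact hp.one_lt.ne' (Nat.dvd_one.1 (by exact_mod_cast h1))

theorem not_nilCyc_one_le {V : ComVariety} {k : ℕ} (hk : 1 ≤ k) (h : V.Pow 1 (k + 1)) :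
    ¬ nilCyc 1 ≤ V := fun hle => by
  have := Pow.min_eq_of_nilCyc_le (s := 0) h hle
  omega

theorem mon_one_pow : (mon 1).Pow 1 2 := mon_pow le_rfl (by omega) le_rfl (by omega)

/-- Every nontrivial subvariety of `V` contains `X`. -/
def OnlyAbove (X V : ComVariety) : Prop := ∀ Y, Y ≤ V → Y ≠ ⊥ → X ≤ Y

/-- The lattice-theoretic characterization of the variety of semilattices. -/
theorem eq_mon_one_iff {X : ComVariety} :
    X = mon 1 ↔ X ≠ ⊥ ∧ OnlyAbove X X ∧ ∀ V, OnlyAbove X V → V ≤ X := by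
  have cyc_ne (p : ℕ) (hp : p.Prime) : cyc p ≠ ⊥ := fun h =>
    not_cyc_le hp mon_one_pow (h.trans_le bot_le)
  have nil_ne : nilCyc 1 ≠ ⊥ := fun h =>
    not_nilCyc_one_le le_rfl mon_one_pow (h.trans_le bot_le)
  have mon_ne : mon 1 ≠ ⊥ := fun h =>
    not_mon_one_le (by omega) (nilCyc_two (le_refl 2)) (h.trans_le bot_le)
  constructor
  · rintro rfl
    refine ⟨mon_ne, fun Y hY hne => ?_, fun V hV => ?_⟩
    · rcases exists_le_of_ne_bot hne with ⟨p, hp, h⟩ | h | h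
      · exact absurd (h.trans hY) (not_cyc_le hp mon_one_pow)
      · exact absurd (h.trans hY) (not_nilCyc_one_le le_rfl mon_one_pow)
      · exact h
    · refine le_mon_of_pow (pow_one_two (fun p hp h => ?_) fun h => ?_)
      · exact not_mon_one_le hp.one_lt.le (cyc_two hp.one_lt.le dvd_rfl) (hV _ h (cyc_ne p hp))
      · exact not_mon_one_le (by omega) (nilCyc_two (le_refl 2)) (hV _ h nil_ne)
  · rintro ⟨hne, hX, hV⟩
    rcases exists_le_of_ne_bot hne with ⟨p, hp, h⟩ | h | h
    · obtain rfl := le_antisymm (hX _ h (cyc_ne p hp)) h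
      have hp1 := hp.one_lt
      have hle : cyc (p ^ 2) ≤ cyc p := hV _ fun Y hY hY0 => by
        have hpos : 1 ≤ p ^ 2 := Nat.one_le_pow _ _ hp.pos
        rcases exists_le_of_ne_bot hY0 with ⟨q, hq, h'⟩ | h' | h'
        · have h1 := (cyc_pow (d := p ^ 2) (s := 1 + p ^ 2) (t := 1) (by omega) le_rfl
            (by simp)).dvd_of_cyc_le (h'.trans hY)
          have h2 : q ∣ p ^ 2 := by
            rw [← Int.natCast_dvd_natCast]
            simpa using h1
          exact (Nat.prime_dvd_prime_iff_eq hq hp).1 (hq.dvd_of_dvd_pow h2) ▸ h'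
        · exact absurd (h'.trans hY) (not_nilCyc_one_le hpos
            (cyc_pow (d := p ^ 2) le_rfl (by omega) (by simp)))
        · exact absurd (h'.trans hY) (not_mon_one_le hpos (cyc_two hpos dvd_rfl))
      have h1 := (cyc_pow (d := p) (s := 1 + p) (t := 1) (by omega) le_rfl
        (by simp)).dvd_of_cyc_le hle
      have h2 : p ^ 2 ∣ p := by
        rw [← Int.natCast_dvd_natCast]
        simpa using h1
      have := Nat.le_of_dvd hp.pos h2
      nlinarith
    · obtain rfl := le_antisymm (hX _ h nil_ne) h
      have hle : nilCyc 2 ≤ nilCyc 1 := hV _ fun Y hY hY0 => by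
        rcases exists_le_of_ne_bot hY0 with ⟨q, hq, h'⟩ | h' | h'
        · exact absurd (h'.trans hY) (not_cyc_le hq (nilCyc_pow (le_refl 3) (by omega)))
        · exact h'
        · exact absurd (h'.trans hY) (not_mon_one_le (by omega) (nilCyc_two (le_refl 3)))
      have := Pow.min_eq_of_nilCyc_le (s := 1) (t := 2)
        (nilCyc_pow (k := 1) le_rfl (by omega)) hle
      omega
    · exact le_antisymm (hX _ h mon_ne) h

/-! ### Join-irreducible varieties -/

/-- `V` is not the join of two varieties distinct from `V`. -/
def JoinIrred (V : ComVariety) : Prop := ∀ Y Z, V = Y ⊔ Z → V = Y ∨ V = Z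

theorem exists_two_of_not_mon_le {V : ComVariety} {m n : ℕ} (h : ¬ mon (m + 1) ≤ V)
    (hn : 1 ≤ n) (hpow : V.Pow n (n + n)) : ∃ k ≥ 1, ∀ c, V.Two m n (m + c * k) n := by
  have key : ∀ i j k l, i < k → i ≤ m → V.Two i j k l → V.Two m n (m + (k - i)) n := by
    intro i j k l hik him h S hS a b
    have hb : ∀ r, (b : WithOne S.carrier) ^ (n + n * r) = b ^ n := fun r => by
      rw [mul_comm, ← hpow.iterate le_rfl r S hS b]
    have := congrArg (· * ((a : WithOne S.carrier) ^ (m - i) * b ^ n))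
      (h.pow_right hn S hS a b)
    simp only [mul_mul_mul_comm, ← pow_add] at this
    rw [add_comm _ n, add_comm _ n, hb, hb] at this
    convert this using 3 <;> omega
  have hbase : ∃ k ≥ 1, V.Two m n (m + k) n := by
    rw [mon_le_iff] at h
    push Not at h
    obtain ⟨u, v, huv, x, hne, h⟩ := h
    have h1 := two_of_mem huv x
    rcases lt_or_gt_of_ne hne with hlt | hlt
    · exact ⟨_, by omega, key _ _ _ _ hlt (by by_contra hc; have := h (by omega); omega) h1⟩
    · exact ⟨_, by omega, key _ _ _ _ hlt (by by_contra hc; have := h (by omega); omega)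
        fun S hS a b => (h1 S hS a b).symm⟩
  obtain ⟨k, hk, h⟩ := hbase
  refine ⟨k, hk, fun c => ?_⟩
  induction c with
  | zero => exact fun _ _ _ _ => by simp
  | succ c ih =>
    intro S hS a b
    rw [add_mul, one_mul, ← add_assoc, pow_add, mul_right_comm, ← ih S hS a b, mul_right_comm,
      ← pow_add, h S hS a b]

theorem mon_joinIrred {m : ℕ} (hm : 1 ≤ m) : JoinIrred (mon m) := by
  intro Y Z hYZ
  obtain ⟨m, rfl⟩ := Nat.exists_eq_add_of_le' hm
  by_contra hcon
  push Not at hcon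
  have key : ∀ W ≤ mon (m + 1), mon (m + 1) ≠ W → W.Two m (m + 1) (m + 1) (m + 1) := by
    intro W hW hne
    have hpow : ∀ t ≥ m + 1, W.Pow (m + 1) t := fun t ht =>
      (mon_pow hm (by omega) le_rfl ht).mono hW
    obtain ⟨k, hk, h⟩ := exists_two_of_not_mon_le (fun h => hne (le_antisymm h hW)) hm
      (hpow (m + 1 + (m + 1)) (by omega))
    intro S hS a b
    rw [h (m + 1) S hS a b, hpow (m + (m + 1) * k) (by nlinarith) S hS a]
  have h := two_sup (by omega) (by omega) (key Y (hYZ ▸ le_sup_left) hcon.1)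
    (key Z (hYZ ▸ le_sup_right) hcon.2)
  have := h.of_mon_le hYZ.le
  omega

theorem exists_cnt_ne {V : ComVariety} (h : V ≠ ⊤) :
    ∃ u v, (u, v) ∈ V.theory ∧ ∃ x, cnt x u ≠ cnt x v := by
  by_contra hcon
  push Not at hcon
  refine h (top_le_iff.1 fun ⟨u, v⟩ huv => mem_theory_iff.2 fun S _ f => ?_)
  apply WithOne.coe_injective
  simp only [coe_lift]
  exact lift_eq_of_pow_eq fun x => by rw [hcon u v huv x]

theorem exists_period_of_ne_top {V : ComVariety} (h : V ≠ ⊤) : ∃ d ≥ 1, cyc d ≤ V ∧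
    ∃ t, V.Pow t (t + d) := by
  obtain ⟨d, ht, hd⟩ := V.exists_period
  obtain ⟨u, v, huv, x, hx⟩ := exists_cnt_ne h
  have hd1 : 1 ≤ d := by
    by_contra h0
    obtain rfl : d = 0 := by omega
    have h1 := hd _ _ ((two_of_mem huv x).pow (r := cnt x u + cnt x v + 1) (by omega))
    rw [Nat.cast_zero, zero_dvd_iff, sub_eq_zero, Nat.cast_inj] at h1
    rcases lt_trichotomy (oth x u) (oth x v) with h2 | h2 | h2
    · nlinarith
    · rw [h2] at h1; omega
    · nlinarith
  exact ⟨d, hd1, cyc_le_of_forall_pow hd1 hd, ht⟩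

theorem theory_refl (V : ComVariety) (u : SGWord) : (u, u) ∈ V.theory :=
  mem_theory_iff.2 fun _ _ _ => rfl

theorem theory_symm {V : ComVariety} {u v : SGWord} (h : (u, v) ∈ V.theory) :
    (v, u) ∈ V.theory := mem_theory_iff.2 fun _ hS f => (hS _ h f).symm

theorem theory_trans {V : ComVariety} {u v w : SGWord} (h : (u, v) ∈ V.theory)
    (h' : (v, w) ∈ V.theory) : (u, w) ∈ V.theory :=
  mem_theory_iff.2 fun _ hS f => (hS _ h f).trans (hS _ h' f)

theorem theory_mul {V : ComVariety} {u v u' v' : SGWord} (h : (u, v) ∈ V.theory)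
    (h' : (u', v') ∈ V.theory) : (u * u', v * v') ∈ V.theory :=
  mem_theory_iff.2 fun S hS f => by
    have h1 := hS _ h f
    have h2 := hS _ h' f
    simp only [map_mul] at h1 h2 ⊢
    rw [h1, h2]

theorem theory_comm (V : ComVariety) (u v : SGWord) : (u * v, v * u) ∈ V.theory :=
  mem_theory_iff.2 fun S _ f => by simp only [map_mul, mul_comm]

theorem theory_lift {V : ComVariety} {u v : SGWord} (h : (u, v) ∈ V.theory) (g : ℕ → SGWord) :
    (FreeSemigroup.lift g u, FreeSemigroup.lift g v) ∈ V.theory :=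
  mem_theory_iff.2 fun S hS f => by
    simp only [lift_lift]
    exact hS _ h _

/-- `u` equals in `V` a word in which some letter occurs at least `n` times. -/
def HasPower (V : ComVariety) (n : ℕ) (u : SGWord) : Prop :=
  ∃ u', (u, u') ∈ V.theory ∧ ∃ x, n ≤ cnt x u'

theorem HasPower.congr {V : ComVariety} {n : ℕ} {u v : SGWord} (h : (u, v) ∈ V.theory)
    (hv : V.HasPower n v) : V.HasPower n u := by
  obtain ⟨v', hv', hx⟩ := hv
  exact ⟨v', theory_trans h hv', hx⟩

theorem HasPower.mul_right {V : ComVariety} {n : ℕ} {u : SGWord} (h : V.HasPower n u)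
    (v : SGWord) : V.HasPower n (u * v) := by
  obtain ⟨u', hu, x, hx⟩ := h
  exact ⟨u' * v, theory_mul hu (theory_refl V v), x, by rw [cnt_mul]; omega⟩

theorem HasPower.mul_left {V : ComVariety} {n : ℕ} {u : SGWord} (h : V.HasPower n u)
    (v : SGWord) : V.HasPower n (v * u) := (h.mul_right v).congr (theory_comm V v u)

/-- The congruence on words of the Rees quotient of the free semigroup of `V` by the ideal of
words with an `n`-th power. -/
def nilCon (V : ComVariety) (n : ℕ) : Con SGWord where
  r u v := (u, v) ∈ V.theory ∨ V.HasPower n u ∧ V.HasPower n v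
  iseqv :=
    { refl := fun u => Or.inl (theory_refl V u)
      symm := fun h => h.imp theory_symm And.symm
      trans := by
        rintro u v w (h | ⟨h1, h2⟩) (h' | ⟨h1', h2'⟩)
        · exact Or.inl (theory_trans h h')
        · exact Or.inr ⟨h1'.congr h, h2'⟩
        · exact Or.inr ⟨h1, h2.congr (theory_symm h')⟩
        · exact Or.inr ⟨h1, h2'⟩ }
  mul' := by
    rintro u v u' v' (h | ⟨h1, h2⟩) (h' | ⟨h1', h2'⟩)
    · exact Or.inl (theory_mul h h')
    · exact Or.inr ⟨h1'.mul_left _, h2'.mul_left _⟩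
    · exact Or.inr ⟨h1.mul_right _, h2.mul_right _⟩
    · exact Or.inr ⟨h1.mul_right _, h2.mul_right _⟩

instance (V : ComVariety) (n : ℕ) : CommSemigroup (V.nilCon n).Quotient where
  mul_comm a b := by
    induction a, b using Con.induction_on₂ with
    | H u v => exact (Con.eq _).2 (Or.inl (theory_comm V u v))

/-- The variety generated by the Rees quotient of the free semigroup of `V` by the ideal of words
with an `n`-th power. -/
def nilPart (V : ComVariety) (n : ℕ) : ComVariety :=
  gen { carrier := (V.nilCon n).Quotient, instNonempty := ⟨((ltr 0 : SGWord) : _)⟩ }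

theorem lift_coe_nilCon (V : ComVariety) (n : ℕ) (g : ℕ → SGWord) (u : SGWord) :
    FreeSemigroup.lift (fun x => ((g x : SGWord) : (V.nilCon n).Quotient)) u =
      (FreeSemigroup.lift g u : SGWord) :=
  (lift_comp (⟨fun w => (w : (V.nilCon n).Quotient), fun _ _ => rfl⟩ :
    SGWord →ₙ* (V.nilCon n).Quotient) g u).symm

theorem mem_nilPart_theory {V : ComVariety} {n : ℕ} {u v : SGWord} :
    (u, v) ∈ (nilPart V n).theory ↔ ∀ g : ℕ → SGWord,
      V.nilCon n (FreeSemigroup.lift g u) (FreeSemigroup.lift g v) := by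
  rw [nilPart, mem_gen_theory]
  constructor
  · intro h g
    have := h fun x => ((g x : SGWord) : (V.nilCon n).Quotient)
    simp only [lift_coe_nilCon] at this
    exact (Con.eq _).1 this
  · intro h f
    choose g hg using fun x => Quotient.exists_rep (f x)
    obtain rfl : (fun x => ((g x : SGWord) : (V.nilCon n).Quotient)) = f := funext hg
    simp only [lift_coe_nilCon]
    exact (Con.eq _).2 (h g)

theorem nilPart_le (V : ComVariety) (n : ℕ) : nilPart V n ≤ V := fun ⟨_, _⟩ h =>
  mem_nilPart_theory.2 fun g => Or.inl (theory_lift h g)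

theorem nilPart_two (V : ComVariety) {n : ℕ} (hn : 1 ≤ n) : (nilPart V n).Two n 0 0 n := by
  have key : ∀ (g : ℕ → SGWord) (x : ℕ),
      V.HasPower n (FreeSemigroup.lift g (wpow (ltr x) n)) := by
    intro g x
    refine ⟨_, theory_refl V _, (g x).head, ?_⟩
    have h : FreeSemigroup.lift g (wpow (ltr x) n) = wpow (g x) n := by
      clear hn
      induction n using wpow.induct with
      | case1 => simp [wpow, ltr]
      | case2 => simp [wpow, ltr]
      | case3 n ih => rw [wpow, map_mul, ih]; simp [wpow, ltr]
    rw [h, cnt_wpow _ _ hn]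
    exact Nat.le_mul_of_pos_right n (cnt_head_pos _)
  have h := two_of_mem (mem_nilPart_theory.2 fun g => Or.inr ⟨key g 0, key g 1⟩) 0
  rw [cnt_wpow _ _ hn, cnt_wpow _ _ hn, oth_wpow _ _ hn, oth_wpow _ _ hn] at h
  simpa [ltr, cnt_of, oth_of] using h

theorem nilCon_of_mem_nilPart {V : ComVariety} {n : ℕ} {u v : SGWord}
    (h : (u, v) ∈ (nilPart V n).theory) :
    (u, v) ∈ V.theory ∨ V.HasPower n u ∧ V.HasPower n v := by
  have hid : FreeSemigroup.lift (FreeSemigroup.of : ℕ → SGWord) = MulHom.id _ :=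
    FreeSemigroup.lift_comp_of' (MulHom.id SGWord)
  have := mem_nilPart_theory.1 h FreeSemigroup.of
  rwa [hid] at this

theorem prod_mul_eq_prod_mul {M ι : Type*} [CommMonoid M] {g g' : ι → M} {e : M}
    (h : ∀ x, g x * e = g' x * e) (s : Finset ι) :
    (∏ x ∈ s, g x) * e = (∏ x ∈ s, g' x) * e := by
  classical
  induction s using Finset.induction_on with
  | empty => simp
  | insert x s hx ih =>
    rw [Finset.prod_insert hx, Finset.prod_insert hx, mul_assoc, ih, mul_left_comm, h x,
      mul_left_comm, mul_assoc]

theorem Pow.of_dvd {V : ComVariety} {n d s t : ℕ} (h : V.Pow n (n + d)) (hs : n ≤ s)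
    (ht : n ≤ t) (hst : (d : ℤ) ∣ (s : ℤ) - t) : V.Pow s t := by
  have key : ∀ s t : ℕ, n ≤ s → s ≤ t → (d : ℤ) ∣ (t : ℤ) - s → V.Pow s t := by
    intro s t hs hst hd
    rw [← Nat.cast_sub hst, Int.natCast_dvd_natCast] at hd
    obtain ⟨j, hj⟩ := hd
    have := h.iterate hs j
    rwa [mul_comm, ← hj, Nat.add_sub_cancel' hst] at this
  rcases le_total s t with hle | hle
  · exact key s t hs hle (dvd_sub_comm.1 hst)
  · exact (key t s ht hle hst).symm

/-- The decomposition of a periodic variety into a group part, a monoid part and a nil part. -/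
theorem le_sup_nilPart {V : ComVariety} {d m n : ℕ} (hd : 1 ≤ d) (hn : 1 ≤ n) (hdn : d ∣ n)
    (hpow : V.Pow n (n + d)) (hcyc : cyc d ≤ V) (hmon : mon m ≤ V)
    (hmon' : ¬ mon (m + 1) ≤ V) : V ≤ cyc d ⊔ mon m ⊔ nilPart V n := by
  rintro ⟨u, v⟩ huv
  have hucyc : ∀ x, (d : ℤ) ∣ (cnt x u : ℤ) - cnt x v :=
    cnt_dvd_of_forall_pow hd (fun s t h => h.dvd_of_cyc_le le_rfl)
      (le_sup_left.trans (le_sup_left (b := nilPart V n)) huv : (u, v) ∈ (cyc d).theory)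
  have humon := mon_le_iff.1 (le_sup_right.trans le_sup_left) u v huv
  rcases nilCon_of_mem_nilPart ((le_sup_right : nilPart V n ≤ _) huv) with
    h | ⟨⟨u', hu, x₀, hx₀⟩, ⟨v', hv, y₀, hy₀⟩⟩
  · exact h
  suffices (u', v') ∈ V.theory from theory_trans hu (theory_trans this (theory_symm hv))
  have hdvd : ∀ x, (d : ℤ) ∣ (cnt x u' : ℤ) - cnt x v' := fun x => by
    have hdV {w w' : SGWord} (h : (w, w') ∈ V.theory) : (d : ℤ) ∣ (cnt x w : ℤ) - cnt x w' :=
      cnt_dvd_of_forall_pow hd (fun s t h => h.dvd_of_cyc_le hcyc) h x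
    have h1 := dvd_add (dvd_add (hdV (theory_symm hu)) (hucyc x)) (hdV hv)
    rwa [sub_add_sub_cancel, sub_add_sub_cancel] at h1
  have hm : ∀ x, cnt x u' = cnt x v' ∨ m ≤ cnt x u' ∧ m ≤ cnt x v' := fun x => by
    have h1 := mon_le_iff.1 hmon u u' hu x
    have h2 := mon_le_iff.1 hmon v v' hv x
    have h3 := humon x
    omega
  have hmn : m ≤ n := hpow.le_of_mon_le (by omega) hmon
  have habs : ∀ s ≥ n, V.Pow s (s + n) := fun s hs =>
    hpow.of_dvd hs (by omega) (by simpa using Int.natCast_dvd_natCast.2 hdn)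
  obtain ⟨k, hk, htwo⟩ := exists_two_of_not_mon_le hmon' hn (habs n le_rfl)
  have hnk : n ≤ n * k := Nat.le_mul_of_pos_right n hk
  refine mem_theory_iff.2 fun S hS f => ?_
  apply WithOne.coe_injective
  simp only [coe_lift]
  have hlocal : ∀ x y, (f x : WithOne S.carrier) ^ cnt x u' * (f y : WithOne S.carrier) ^ n =
      f x ^ cnt x v' * f y ^ n := by
    intro x y
    rcases hm x with h | ⟨h1, h2⟩
    · rw [h]
    have raise : ∀ s ≥ m, (f x : WithOne S.carrier) ^ s * (f y : WithOne S.carrier) ^ n =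
        f x ^ (s + n * k) * f y ^ n := by
      intro s hs
      obtain ⟨r, rfl⟩ := Nat.exists_eq_add_of_le' hs
      rw [pow_add, mul_assoc, htwo n S hS, ← mul_assoc, ← pow_add, add_assoc]
    have hP : V.Pow (cnt x u' + n * k) (cnt x v' + n * k) :=
      hpow.of_dvd (by omega) (by omega) (by
        rw [Nat.cast_add, Nat.cast_add, add_sub_add_right_eq_sub]
        exact hdvd x)
    rw [raise _ h1, raise _ h2, hP S hS]
  obtain ⟨N, hN, hprod⟩ := exists_lift_eq_prod₂ u' v' (max (x₀ + 1) (y₀ + 1))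
  obtain ⟨hpu, hpv⟩ := hprod fun x => (f x : WithOne S.carrier)
  rw [hpu, hpv]
  have hall (y : ℕ) := prod_mul_eq_prod_mul (fun x => hlocal x y) (Finset.range N)
  have absorb : ∀ (w : SGWord) (y : ℕ), y < N → n ≤ cnt y w →
      (∏ x ∈ Finset.range N, (f x : WithOne S.carrier) ^ cnt x w) * f y ^ n =
        ∏ x ∈ Finset.range N, (f x : WithOne S.carrier) ^ cnt x w := by
    intro w y hy hw
    rw [← Finset.mul_prod_erase _ _ (Finset.mem_range.2 hy), mul_right_comm, ← pow_add,
      ← habs _ hw S hS]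
  have hu1 := absorb u' x₀ (by omega) hx₀
  have hv1 := absorb v' y₀ (by omega) hy₀
  calc _ = (∏ x ∈ Finset.range N, (f x : WithOne S.carrier) ^ cnt x v') * f x₀ ^ n := by
        rw [← hall, hu1]
    _ = (∏ x ∈ Finset.range N, (f x : WithOne S.carrier) ^ cnt x u') * f y₀ ^ n * f x₀ ^ n := by
        rw [hall y₀, hv1]
    _ = _ := by rw [mul_right_comm, hu1, hall y₀, hv1]

/-- The join-irreducible proper varieties containing the variety of semilattices. -/
theorem exists_eq_mon_iff {V : ComVariety} :
    (∃ m ≥ 1, V = mon m) ↔ mon 1 ≤ V ∧ V ≠ ⊤ ∧ JoinIrred V := by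
  constructor
  · rintro ⟨m, hm, rfl⟩
    refine ⟨(mon_le_mon hm).2 hm, fun h => ?_, mon_joinIrred hm⟩
    have := (mon_le_mon (k := m + 1) hm).1 (h ▸ le_top)
    omega
  · rintro ⟨hSL, htop, hirr⟩
    obtain ⟨d, hd, hcyc, t, ht⟩ := exists_period_of_ne_top htop
    have hn : 1 ≤ d * (t + 1) := Nat.mul_pos hd t.succ_pos
    have hpow : V.Pow (d * (t + 1)) (d * (t + 1) + d) := by
      simpa using ht.iterate (n := d * (t + 1)) (by nlinarith) 1
    obtain ⟨m, hm, hmon, hmon'⟩ : ∃ m ≥ 1, mon m ≤ V ∧ ¬ mon (m + 1) ≤ V := by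
      by_contra hcon
      push Not at hcon
      have hall : ∀ m ≥ 1, mon m ≤ V := fun m hm => by
        induction m, hm using Nat.le_induction with
        | base => exact hSL
        | succ m hm ih => exact hcon m hm ih
      have := hpow.le_of_mon_le (by omega) (hall (d * (t + 1) + 1) (by omega))
      omega
    refine ⟨m, hm, ?_⟩
    have hdn : d ∣ d * (t + 1) := dvd_mul_right _ _
    have heq := le_antisymm (le_sup_nilPart hd hn hdn hpow hcyc hmon hmon')
      (sup_le (sup_le hcyc hmon) (nilPart_le V _))
    rcases hirr _ _ heq with h | h
    · rcases hirr _ _ h with h | h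
      · exact absurd (h ▸ hSL) (not_mon_one_le hd (cyc_two hd dvd_rfl))
      · exact h
    · exact absurd (h.le.trans' hSL) (not_mon_one_le hn (nilPart_two V hn))

theorem eq_mon_succ_iff {V : ComVariety} {m : ℕ} (hm : 1 ≤ m) : V = mon (m + 1) ↔
    (∃ k ≥ 1, V = mon k) ∧ ¬ V ≤ mon m ∧ ∀ U, (∃ k ≥ 1, U = mon k) → ¬ U ≤ mon m → V ≤ U := by
  constructor
  · rintro rfl
    refine ⟨⟨m + 1, by omega, rfl⟩, by rw [mon_le_mon hm]; omega, ?_⟩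
    rintro U ⟨k, hk, rfl⟩ h
    rw [mon_le_mon hm] at h
    rw [mon_le_mon hk]; omega
  · rintro ⟨⟨k, hk, rfl⟩, h1, h2⟩
    have h3 := h2 (mon (m + 1)) ⟨m + 1, by omega, rfl⟩ (by rw [mon_le_mon hm]; omega)
    rw [mon_le_mon hm] at h1
    rw [mon_le_mon (by omega)] at h3
    rw [show k = m + 1 by omega]

end ComVariety

/-! ### Definable relations in a lattice -/

/-- A relation on the values of variables indexed by `ℕ` is definable if it is the truth set of
a first-order formula in the language of lattices. -/
def DefRel {L : Type*} [Lattice L] (R : (ℕ → L) → Prop) : Prop :=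
  ∃ φ : latticeLang.Formula ℕ, ∀ v, φ.Realize v ↔ R v

namespace DefRel

variable {L : Type*} [Lattice L] {R R' : (ℕ → L) → Prop}

theorem not (h : DefRel R) : DefRel fun v => ¬ R v := by
  obtain ⟨φ, hφ⟩ := h
  exact ⟨φ.not, fun v => Language.Formula.realize_not.trans (hφ v).not⟩

theorem imp (h : DefRel R) (h' : DefRel R') : DefRel fun v => R v → R' v := by
  obtain ⟨φ, hφ⟩ := h
  obtain ⟨ψ, hψ⟩ := h'
  exact ⟨φ.imp ψ, fun v => Language.Formula.realize_imp.trans (imp_congr (hφ v) (hψ v))⟩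

theorem and (h : DefRel R) (h' : DefRel R') : DefRel fun v => R v ∧ R' v := by
  simpa only [Classical.not_imp, Classical.not_not] using (h.imp h'.not).not

theorem or (h : DefRel R) (h' : DefRel R') : DefRel fun v => R v ∨ R' v := by
  simpa only [or_iff_not_imp_left] using h.not.imp h'

theorem comp (h : DefRel R) (g : ℕ → ℕ) : DefRel fun v => R (v ∘ g) := by
  obtain ⟨φ, hφ⟩ := h
  exact ⟨φ.subst fun i => Language.Term.var (g i), fun v =>
    Language.BoundedFormula.realize_subst.trans (hφ _)⟩

theorem all (h : DefRel R) (k : ℕ) : DefRel fun v => ∀ a, R (Function.update v k a) := by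
  obtain ⟨φ, hφ⟩ := h
  refine ⟨Language.Formula.iAlls Unit (φ.subst fun i => Language.Term.var
    (if i = k then Sum.inr () else Sum.inl i)), fun v => ?_⟩
  rw [Language.Formula.realize_iAlls, (Equiv.funUnique Unit L).forall_congr_left]
  refine forall_congr' fun a => ?_
  refine Language.BoundedFormula.realize_subst.trans ((hφ _).trans ?_)
  refine iff_of_eq (congrArg R (funext fun i => ?_))
  by_cases h : i = k <;> simp [h]

theorem eq_sup (i j k : ℕ) : DefRel fun v : ℕ → L => v i = v j ⊔ v k :=
  ⟨(Language.Term.var i).equal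
    (Language.Term.func (L := latticeLang) (l := 2) (show Bool from true)
      ![Language.Term.var j, Language.Term.var k]),
    fun _ => Language.Formula.realize_equal⟩

theorem le (i j : ℕ) : DefRel fun v : ℕ → L => v i ≤ v j := by
  simpa only [right_eq_sup] using eq_sup (L := L) j i j

theorem eq (i j : ℕ) : DefRel fun v : ℕ → L => v i = v j := by
  simpa only [le_antisymm_iff] using (le (L := L) i j).and (le j i)

end DefRel

/-- A definable property of lattice elements defines a definable subset. -/
theorem DefRel.latDefinable {L : Type*} [Lattice L] {P : L → Prop}
    (h : DefRel fun v => P (v 0)) : LatDefinable L {a | P a} := by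
  obtain ⟨φ, hφ⟩ := h
  exact ⟨φ.subst fun _ => Language.Term.var 0, fun a =>
    Language.BoundedFormula.realize_subst.trans (hφ _)⟩

namespace ComVariety

theorem defRel_eq_bot (i : ℕ) : DefRel fun v : ℕ → ComVariety => v i = ⊥ := by
  have h := (DefRel.le (L := ComVariety) 0 1).all 1
  simpa [← isBot_iff_eq_bot, IsBot] using h.comp fun _ => i

theorem defRel_eq_top (i : ℕ) : DefRel fun v : ℕ → ComVariety => v i = ⊤ := by
  have h := (DefRel.le (L := ComVariety) 1 0).all 1
  simpa [← isTop_iff_eq_top, IsTop] using h.comp fun _ => i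

theorem defRel_onlyAbove (i j : ℕ) :
    DefRel fun v : ℕ → ComVariety => OnlyAbove (v i) (v j) := by
  have h := ((DefRel.le (L := ComVariety) 2 1).imp
    ((defRel_eq_bot 2).not.imp (DefRel.le 0 2))).all 2
  simpa [OnlyAbove] using h.comp fun k => if k = 0 then i else j

theorem defRel_eq_mon_one (i : ℕ) : DefRel fun v : ℕ → ComVariety => v i = mon 1 := by
  have h := (defRel_eq_bot 0).not.and ((defRel_onlyAbove 0 0).and
    (((defRel_onlyAbove 0 1).imp (DefRel.le 1 0)).all 1))
  simpa [eq_mon_one_iff] using h.comp fun _ => i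

theorem defRel_joinIrred (i : ℕ) : DefRel fun v : ℕ → ComVariety => JoinIrred (v i) := by
  have h := (((DefRel.eq_sup (L := ComVariety) 0 1 2).imp
    ((DefRel.eq 0 1).or (DefRel.eq 0 2))).all 2).all 1
  simpa [JoinIrred] using h.comp fun _ => i

theorem defRel_exists_eq_mon (i : ℕ) :
    DefRel fun v : ℕ → ComVariety => ∃ m ≥ 1, v i = mon m := by
  have h := (((defRel_eq_mon_one 1).imp (DefRel.le 1 0)).all 1).and
    ((defRel_eq_top 0).not.and (defRel_joinIrred 0))
  simpa [exists_eq_mon_iff] using h.comp fun _ => i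

theorem defRel_eq_mon {m : ℕ} (hm : 1 ≤ m) (i : ℕ) :
    DefRel fun v : ℕ → ComVariety => v i = mon m := by
  induction m, hm using Nat.le_induction generalizing i with
  | base => exact defRel_eq_mon_one i
  | succ m hm ih =>
    have h := (defRel_exists_eq_mon 0).and (((ih 1).imp ((DefRel.le 0 1).not.and
      (((defRel_exists_eq_mon 2).imp ((DefRel.le 2 1).not.imp (DefRel.le 0 2))).all 2))).all 1)
    simpa [eq_mon_succ_iff hm] using h.comp fun _ => i

end ComVariety

/-- **Theorem.** For each `m ≥ 0`, the variety `C m` (generated by the cyclic monoid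
`⟨a ∣ aᵐ = aᵐ⁺¹⟩`, explicitly `var{xᵐ = xᵐ⁺¹, xy = yx}` for `m ≥ 1`, and the trivial
variety for `m = 0`) is a definable element of the lattice **Com**. -/
theorem definable_Cvar (m : ℕ) :
    LatDefinable ComVariety {V : ComVariety | V = Cvar m} := by
  apply DefRel.latDefinable (P := fun V => V = Cvar m)
  obtain _ | m := m
  · simpa only [ComVariety.cvar_zero] using ComVariety.defRel_eq_bot 0
  · simpa only [ComVariety.cvar_eq_mon] using ComVariety.defRel_eq_mon m.succ_pos 0
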